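/- Fix real numbers a > 1 and ε, let A, Λ : ℝ → ℝ satisfy A(x+1) = a·A(x) and Λ(x+1) = Λ(x) + ε·A(x)³ for all x, assume A(x) > 0 for all x, and let f : ℝ → ℝ be 1-periodic (f(x+1) = f(x)) with 1 + Λ(x)·f(x) > 0 for all x. Write M(x) = G(A(x)³, Λ(x), f(x)) and N(x) = Q(A(x)³, Λ(x), f(x)). Then for every real x and every integer n: a^{−n}·( M(x) + ε·((1 − a^{3n})/(1 − a³))·N(x) ) = ( det M(x) / det M(x+n) )^{2/3} · M(x+n), where the exponent 2/3 denotes the real power of the (positive) ratio of determinants. -/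

import Mathlib

/-- The matrix `G(a,ℓ,z)` of the metric `g_{a,ℓ}` at a point where `f(x) = z`. -/
noncomputable def G (a ℓ z : ℝ) : Matrix (Fin 2) (Fin 2) ℝ :=
  a • !![ℓ / (1 + ℓ * z) ^ 2, 1 / (1 + ℓ * z); 1 / (1 + ℓ * z), z / (1 + ℓ * z)]

/-- The matrix `Q(a,ℓ,z)` of the square of the Clairaut integral. -/
noncomputable def Q (a ℓ z : ℝ) : Matrix (Fin 2) (Fin 2) ℝ :=
  (a ^ 2 / (1 + ℓ * z) ^ 2) • !![1, z; z, z ^ 2]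

theorem det_G (a ℓ z : ℝ) (h : 1 + ℓ * z ≠ 0) :
    (G a ℓ z).det = -(a ^ 2 / (1 + ℓ * z) ^ 3) := by
  simp only [G, Matrix.det_fin_two, Matrix.smul_apply, Matrix.of_apply, Matrix.cons_val',
    Matrix.cons_val_zero, Matrix.cons_val_one, Matrix.cons_val_fin_one, smul_eq_mul]
  field_simp
  ring

theorem G_mul (c a ℓ z : ℝ) : G (c * a) ℓ z = c • G a ℓ z :=
  mul_smul c a _

/-- Adding a multiple of `Q` to `G` amounts, up to a conformal factor, to a shift of `ℓ`. -/
theorem G_add_smul_Q (a ℓ z t : ℝ) (h : 1 + ℓ * z ≠ 0) (h' : 1 + (ℓ + t * a) * z ≠ 0) :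
    G a ℓ z + t • Q a ℓ z =
      ((1 + (ℓ + t * a) * z) / (1 + ℓ * z)) ^ 2 • G a (ℓ + t * a) z := by
  generalize hm : ℓ + t * a = m at h' ⊢
  ext i j
  fin_cases i <;> fin_cases j <;>
  · simp only [G, Q, Matrix.add_apply, Matrix.smul_apply, Matrix.of_apply, Matrix.cons_val',
      Matrix.cons_val_zero, Matrix.cons_val_one, Matrix.cons_val_fin_one, smul_eq_mul,
      Fin.zero_eta, Fin.mk_one]
    generalize hd : 1 + m * z = d at h' ⊢
    field_simp
    subst hd hm
    ring

theorem det_ratio_rpow (a ℓ ℓ' z b : ℝ) (ha : a ≠ 0) (hb : 0 < b) (h : 0 < 1 + ℓ * z)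
    (h' : 0 < 1 + ℓ' * z) :
    ((G a ℓ z).det / (G (b ^ 3 * a) ℓ' z).det) ^ ((2 : ℝ) / 3) =
      (b ^ 4)⁻¹ * ((1 + ℓ' * z) / (1 + ℓ * z)) ^ 2 := by
  rw [det_G a ℓ z h.ne', det_G _ ℓ' z h'.ne']
  have hr : -(a ^ 2 / (1 + ℓ * z) ^ 3) / -((b ^ 3 * a) ^ 2 / (1 + ℓ' * z) ^ 3) =
      ((1 + ℓ' * z) / (b ^ 2 * (1 + ℓ * z))) ^ 3 := by
    field_simp
  have hpos : 0 ≤ (1 + ℓ' * z) / (b ^ 2 * (1 + ℓ * z)) := by positivity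
  rw [hr, ← Real.rpow_natCast, ← Real.rpow_mul hpos]
  norm_num
  field_simp

theorem apply_add_intCast_of_mul {a : ℝ} (ha : a ≠ 0) {A : ℝ → ℝ}
    (hA : ∀ x, A (x + 1) = a * A x) (x : ℝ) (n : ℤ) : A (x + n) = a ^ n * A x := by
  induction n with
  | zero => simp
  | succ n ih =>
    have h := hA (x + (n : ℤ))
    rw [ih] at h
    rw [zpow_add_one₀ ha, Int.cast_add, Int.cast_one, ← add_assoc, h]
    ring
  | pred n ih =>
    have h := hA (x + ((-n - 1 : ℤ) : ℝ))
    rw [Int.cast_sub, Int.cast_one, add_assoc, sub_add_cancel, ih] at h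
    rw [zpow_sub_one₀ ha, Int.cast_sub, Int.cast_one]
    field_simp
    linarith

theorem shift_add_intCast {a ε : ℝ} (ha : a ≠ 0) (ha3 : 1 - a ^ 3 ≠ 0) {A Λ : ℝ → ℝ}
    (hA : ∀ x, A (x + 1) = a * A x) (hΛ : ∀ x, Λ (x + 1) = Λ x + ε * A x ^ 3)
    (x : ℝ) (n : ℤ) :
    Λ (x + n) = Λ x + ε * ((1 - a ^ (3 * n)) / (1 - a ^ 3)) * A x ^ 3 := by
  let u : ℝ → ℝ := fun y ↦ Λ y + ε * A y ^ 3 / (1 - a ^ 3)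
  have hu : Function.Periodic u 1 := by
    intro y
    simp only [u, hA, hΛ]
    field_simp
    ring
  have h : u (x + n) = u x := by simpa using hu.int_mul n x
  simp only [u, apply_add_intCast_of_mul ha hA] at h
  rw [eq_sub_of_add_eq h, mul_comm 3 n, zpow_mul]
  norm_cast
  field_simp
  ring

theorem translation_is_projective (a ε : ℝ) (ha : 1 < a) (A Λ f : ℝ → ℝ)
    (hA : ∀ x : ℝ, A (x + 1) = a * A x)
    (hΛ : ∀ x : ℝ, Λ (x + 1) = Λ x + ε * (A x) ^ 3)
    (hApos : ∀ x : ℝ, 0 < A x)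
    (hf : ∀ x : ℝ, f (x + 1) = f x)
    (hnd : ∀ x : ℝ, 0 < 1 + Λ x * f x)
    (M N : ℝ → Matrix (Fin 2) (Fin 2) ℝ)
    (hM : ∀ x : ℝ, M x = G ((A x) ^ 3) (Λ x) (f x))
    (hN : ∀ x : ℝ, N x = Q ((A x) ^ 3) (Λ x) (f x)) :
    ∀ (x : ℝ) (n : ℤ),
      (a : ℝ) ^ (-n) • (M x + (ε * ((1 - a ^ (3 * n)) / (1 - a ^ 3))) • N x) =
        ((M x).det / (M (x + n)).det) ^ ((2 : ℝ) / 3) • M (x + n) := by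
  intro x n
  have ha0 : 0 < a := one_pos.trans ha
  have ha3 : 1 - a ^ 3 ≠ 0 := (sub_neg.2 (one_lt_pow₀ ha three_ne_zero)).ne
  have hb : 0 < a ^ n := zpow_pos ha0 n
  have hD := hnd x
  have hD' := hnd (x + n)
  rw [hM, hM, hN]
  have hfx : f (x + n) = f x := by simpa using Function.Periodic.int_mul hf n x
  rw [shift_add_intCast ha0.ne' ha3 hA hΛ, hfx] at hD' ⊢
  rw [apply_add_intCast_of_mul ha0.ne' hA, mul_pow,
    det_ratio_rpow _ _ _ _ _ (pow_pos (hApos x) 3).ne' hb hD hD',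
    G_add_smul_Q _ _ _ _ hD.ne' hD'.ne', G_mul, smul_smul, smul_smul, zpow_neg]
  congr 1
  field_simp
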